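/- There exists a function e : ℍ → ℂ such that for every τ in the complex upper half-plane ℍ and every z ∈ ℂ the K3 elliptic genus decomposes into N=4 characters: E_K3(τ,z) = −2 χ₀(τ,z) + 20 χ_mm(τ,z) + e(τ)·χ̂(τ,z). -/

import Mathlib

open Complex Real

/-- Jacobi theta function `θ₁(τ,z) = i Σ_{n∈ℤ} (-1)^n q^((n-1/2)²/2) y^(n-1/2)`. -/
noncomputable def theta1 (τ z : ℂ) : ℂ :=
  I * ∑' n : ℤ, (-1 : ℂ) ^ n * Complex.exp (π * I * ((n : ℂ) - 1/2)^2 * τ) *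
    Complex.exp (2 * π * I * ((n : ℂ) - 1/2) * z)

/-- Jacobi theta function `θ₂(τ,z) = Σ_{n∈ℤ} q^((n-1/2)²/2) y^(n-1/2)`. -/
noncomputable def theta2 (τ z : ℂ) : ℂ :=
  ∑' n : ℤ, Complex.exp (π * I * ((n : ℂ) - 1/2)^2 * τ) *
    Complex.exp (2 * π * I * ((n : ℂ) - 1/2) * z)

/-- Jacobi theta function `θ₃(τ,z) = Σ_{n∈ℤ} q^(n²/2) y^n`. -/
noncomputable def theta3 (τ z : ℂ) : ℂ :=
  ∑' n : ℤ, Complex.exp (π * I * (n : ℂ)^2 * τ) * Complex.exp (2 * π * I * (n : ℂ) * z)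

/-- Jacobi theta function `θ₄(τ,z) = Σ_{n∈ℤ} (-1)^n q^(n²/2) y^n`. -/
noncomputable def theta4 (τ z : ℂ) : ℂ :=
  ∑' n : ℤ, (-1 : ℂ) ^ n * Complex.exp (π * I * (n : ℂ)^2 * τ) *
    Complex.exp (2 * π * I * (n : ℂ) * z)

/-- Dedekind eta function `η(τ) = q^(1/24) ∏_{n=1}^∞ (1-q^n)`. -/
noncomputable def dedekindEta (τ : ℂ) : ℂ :=
  Complex.exp (2 * π * I * τ / 24) *
    ∏' n : ℕ, (1 - Complex.exp (2 * π * I * τ) ^ (n + 1))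

/-- The Mordell function `h₃(τ) = (1/(η(τ)θ₃(τ,0))) Σ_{m∈ℤ} q^(m²/2-1/8)/(1+q^(m-1/2))`. -/
noncomputable def mordellH3 (τ : ℂ) : ℂ :=
  (1 / (dedekindEta τ * theta3 τ 0)) *
    ∑' m : ℤ, Complex.exp (2 * π * I * ((m : ℂ)^2 / 2 - 1/8) * τ) /
      (1 + Complex.exp (2 * π * I * ((m : ℂ) - 1/2) * τ))

/-- The `N=4` vacuum character at central charge 6 (twisted Ramond sector):
`χ₀(τ,z) = -2(θ₃(τ,z)/θ₃(τ,0))² + (q^(-1/8)/η(τ) - 2h₃(τ))(θ₁(τ,z)/η(τ))²`. -/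
noncomputable def chi0 (τ z : ℂ) : ℂ :=
  -2 * (theta3 τ z / theta3 τ 0)^2 +
    (Complex.exp (2 * π * I * (-1/8 : ℂ) * τ) / dedekindEta τ - 2 * mordellH3 τ) *
      (theta1 τ z / dedekindEta τ)^2

/-- The massless matter `N=4` character at central charge 6:
`χ_mm(τ,z) = (θ₃(τ,z)/θ₃(τ,0))² + h₃(τ)(θ₁(τ,z)/η(τ))²`. -/
noncomputable def chimm (τ z : ℂ) : ℂ :=
  (theta3 τ z / theta3 τ 0)^2 + mordellH3 τ * (theta1 τ z / dedekindEta τ)^2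

/-- The massive `N=4` character function at central charge 6:
`χ̂(τ,z) = (q^(-1/8)/η(τ))(θ₁(τ,z)/η(τ))²`. -/
noncomputable def chihat (τ z : ℂ) : ℂ :=
  (Complex.exp (2 * π * I * (-1/8 : ℂ) * τ) / dedekindEta τ) *
    (theta1 τ z / dedekindEta τ)^2

/-- The complex elliptic genus of a K3 surface:
`E_K3(τ,z) = 8[(θ₂(τ,z)/θ₂(τ,0))² + (θ₃(τ,z)/θ₃(τ,0))² + (θ₄(τ,z)/θ₄(τ,0))²]`. -/
noncomputable def EK3 (τ z : ℂ) : ℂ :=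
  8 * ((theta2 τ z / theta2 τ 0)^2 + (theta3 τ z / theta3 τ 0)^2 +
    (theta4 τ z / theta4 τ 0)^2)

lemma theta3_eq_jacobiTheta₂ (τ z : ℂ) : theta3 τ z = jacobiTheta₂ z τ := by
  refine tsum_congr fun n ↦ ?_
  rw [jacobiTheta₂_term, ← Complex.exp_add]
  ring_nf

lemma summable_theta3 {τ : ℂ} (hτ : 0 < τ.im) (z : ℂ) :
    Summable fun n : ℤ ↦
      Complex.exp (π * I * (n : ℂ) ^ 2 * τ) * Complex.exp (2 * π * I * (n : ℂ) * z) := by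
  refine ((summable_jacobiTheta₂_term_iff z τ).2 hτ).congr fun n ↦ ?_
  rw [jacobiTheta₂_term, ← Complex.exp_add]
  ring_nf

lemma theta2_term_eq (τ z : ℂ) (n : ℤ) :
    Complex.exp (π * I * ((n : ℂ) - 1 / 2) ^ 2 * τ) *
        Complex.exp (2 * π * I * ((n : ℂ) - 1 / 2) * z) =
      Complex.exp (π * I * (τ / 4 - z)) * jacobiTheta₂_term n (z - τ / 2) τ := by
  rw [jacobiTheta₂_term, ← Complex.exp_add, ← Complex.exp_add]
  ring_nf

lemma theta2_eq_jacobiTheta₂ (τ z : ℂ) :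
    theta2 τ z = Complex.exp (π * I * (τ / 4 - z)) * jacobiTheta₂ (z - τ / 2) τ := by
  rw [theta2, jacobiTheta₂, ← tsum_mul_left]
  exact tsum_congr (theta2_term_eq τ z)

lemma summable_theta2 {τ : ℂ} (hτ : 0 < τ.im) (z : ℂ) :
    Summable fun n : ℤ ↦ Complex.exp (π * I * ((n : ℂ) - 1 / 2) ^ 2 * τ) *
      Complex.exp (2 * π * I * ((n : ℂ) - 1 / 2) * z) := by
  simp_rw [theta2_term_eq]
  exact ((summable_jacobiTheta₂_term_iff _ τ).2 hτ).mul_left _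

lemma exp_two_pi_I_mul_int_mul_half (n : ℤ) :
    Complex.exp (2 * π * I * (n : ℂ) * (1 / 2)) = (-1) ^ n := by
  rw [← Complex.exp_pi_mul_I, ← Complex.exp_int_mul]
  ring_nf

lemma theta4_eq_theta3 (τ z : ℂ) : theta4 τ z = theta3 τ (z + 1 / 2) := by
  refine tsum_congr fun n ↦ ?_
  rw [mul_add (2 * π * I * (n : ℂ)), Complex.exp_add, exp_two_pi_I_mul_int_mul_half]
  ring

lemma theta1_eq_theta2 (τ z : ℂ) : theta1 τ z = -theta2 τ (z + 1 / 2) := by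
  rw [theta1, theta2, ← tsum_mul_left, ← tsum_neg]
  refine tsum_congr fun n ↦ ?_
  have h : Complex.exp (2 * π * I * ((n : ℂ) - 1 / 2) * (z + 1 / 2)) =
      Complex.exp (2 * π * I * ((n : ℂ) - 1 / 2) * z) *
        (Complex.exp (2 * π * I * (n : ℂ) * (1 / 2)) * Complex.exp (-(π / 2 * I))) := by
    rw [← Complex.exp_add, ← Complex.exp_add]
    ring_nf
  rw [h, exp_two_pi_I_mul_int_mul_half, Complex.exp_neg, Complex.exp_pi_div_two_mul_I, inv_I]
  ring

lemma theta3_add_one (τ z : ℂ) : theta3 τ (z + 1) = theta3 τ z := by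
  simp only [theta3_eq_jacobiTheta₂, jacobiTheta₂_add_left]

lemma theta2_add_one (τ z : ℂ) : theta2 τ (z + 1) = -theta2 τ z := by
  rw [theta2_eq_jacobiTheta₂, theta2_eq_jacobiTheta₂, add_sub_right_comm, jacobiTheta₂_add_left,
    ← neg_mul]
  congr 1
  rw [show (π : ℂ) * I * (τ / 4 - (z + 1)) = π * I * (τ / 4 - z) - π * I by ring,
    Complex.exp_sub, Complex.exp_pi_mul_I, div_neg, div_one]

/-- Pairs of integers split by the parity of their sum. -/
noncomputable def intProdParityEquiv (k : ℤ) : (ℤ × ℤ) ⊕ (ℤ × ℤ) ≃ ℤ × ℤ :=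
  Equiv.ofBijective
    (Sum.elim (fun p ↦ (p.1 + p.2, p.1 - p.2)) fun p ↦ (p.1 + p.2 - k, p.1 - p.2 - 1 + k)) <| by
    constructor
    · rintro (⟨a, b⟩ | ⟨a, b⟩) (⟨c, d⟩ | ⟨c, d⟩) h <;>
        simp only [Sum.elim_inl, Sum.elim_inr, Prod.mk.injEq, Sum.inl.injEq, Sum.inr.injEq,
          reduceCtorEq] at h ⊢ <;> omega
    · rintro ⟨m, n⟩
      rcases Int.even_or_odd' (m + n) with ⟨a, h | h⟩
      · exact ⟨Sum.inl (a, m - a), by simp only [Sum.elim_inl, Prod.mk.injEq]; omega⟩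
      · exact ⟨Sum.inr (a + 1, m + k - a - 1), by
          simp only [Sum.elim_inr, Prod.mk.injEq]; omega⟩

lemma tsum_int_prod_eq_add {F : ℤ × ℤ → ℂ} (hF : Summable F) (k : ℤ) :
    ∑' p, F p = ∑' p : ℤ × ℤ, F (p.1 + p.2, p.1 - p.2) +
      ∑' p : ℤ × ℤ, F (p.1 + p.2 - k, p.1 - p.2 - 1 + k) := by
  have h : Summable (F ∘ intProdParityEquiv k) := (intProdParityEquiv k).summable_iff.2 hF
  rw [← (intProdParityEquiv k).tsum_eq F]
  exact Summable.tsum_sum (h.comp_injective Sum.inl_injective)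
    (h.comp_injective Sum.inr_injective)

lemma im_two_mul_pos {τ : ℂ} (hτ : 0 < τ.im) : 0 < (2 * τ).im := by
  simpa using hτ

/-- Landen's transformation for `θ₃`. -/
lemma theta3_sq {τ : ℂ} (hτ : 0 < τ.im) (z : ℂ) :
    theta3 τ z ^ 2 = theta3 (2 * τ) (2 * z) * theta3 (2 * τ) 0 +
      theta2 (2 * τ) (2 * z) * theta2 (2 * τ) 0 := by
  have h := (summable_theta3 hτ z).norm
  have h2 := im_two_mul_pos hτ
  rw [sq, theta3, tsum_mul_tsum_of_summable_norm h h,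
    tsum_int_prod_eq_add (summable_mul_of_summable_norm h h) 1, theta3, theta3, theta2, theta2,
    tsum_mul_tsum_of_summable_norm (summable_theta3 h2 _).norm (summable_theta3 h2 _).norm,
    tsum_mul_tsum_of_summable_norm (summable_theta2 h2 _).norm (summable_theta2 h2 _).norm]
  congr 1 <;> refine tsum_congr fun p ↦ ?_ <;> simp only [← Complex.exp_add] <;> push_cast <;>
    ring_nf

/-- Landen's transformation for `θ₂`. -/
lemma theta2_sq {τ : ℂ} (hτ : 0 < τ.im) (z : ℂ) :
    theta2 τ z ^ 2 = theta3 (2 * τ) (2 * z) * theta2 (2 * τ) 0 +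
      theta2 (2 * τ) (2 * z) * theta3 (2 * τ) 0 := by
  have h := (summable_theta2 hτ z).norm
  have h' := h.comp_injective (add_left_injective (1 : ℤ))
  have h2 := im_two_mul_pos hτ
  have hs : theta2 τ z = ∑' n : ℤ, Complex.exp (π * I * (((n + 1 : ℤ) : ℂ) - 1 / 2) ^ 2 * τ) *
      Complex.exp (2 * π * I * (((n + 1 : ℤ) : ℂ) - 1 / 2) * z) :=
    ((Equiv.addRight (1 : ℤ)).tsum_eq _).symm
  rw [sq]
  nth_rewrite 2 [hs]
  rw [theta2, tsum_mul_tsum_of_summable_norm h h',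
    tsum_int_prod_eq_add (summable_mul_of_summable_norm h h') 0, theta3, theta3, theta2, theta2,
    tsum_mul_tsum_of_summable_norm (summable_theta3 h2 _).norm (summable_theta2 h2 _).norm,
    tsum_mul_tsum_of_summable_norm (summable_theta2 h2 _).norm (summable_theta3 h2 _).norm]
  congr 1 <;> refine tsum_congr fun p ↦ ?_ <;> simp only [← Complex.exp_add] <;> push_cast <;>
    ring_nf

lemma theta4_sq {τ : ℂ} (hτ : 0 < τ.im) (z : ℂ) :
    theta4 τ z ^ 2 = theta3 (2 * τ) (2 * z) * theta3 (2 * τ) 0 -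
      theta2 (2 * τ) (2 * z) * theta2 (2 * τ) 0 := by
  rw [theta4_eq_theta3, theta3_sq hτ, show 2 * (z + 1 / 2) = 2 * z + 1 by ring, theta3_add_one,
    theta2_add_one]
  ring

lemma theta1_sq {τ : ℂ} (hτ : 0 < τ.im) (z : ℂ) :
    theta1 τ z ^ 2 = theta3 (2 * τ) (2 * z) * theta2 (2 * τ) 0 -
      theta2 (2 * τ) (2 * z) * theta3 (2 * τ) 0 := by
  rw [theta1_eq_theta2, neg_sq, theta2_sq hτ, show 2 * (z + 1 / 2) = 2 * z + 1 by ring,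
    theta3_add_one, theta2_add_one]
  ring

lemma theta2_sq_mul_theta3_zero_sq {τ : ℂ} (hτ : 0 < τ.im) (z : ℂ) :
    theta2 τ z ^ 2 * theta3 τ 0 ^ 2 =
      theta3 τ z ^ 2 * theta2 τ 0 ^ 2 - theta4 τ 0 ^ 2 * theta1 τ z ^ 2 := by
  simp only [theta1_sq hτ, theta2_sq hτ, theta3_sq hτ, theta4_sq hτ, mul_zero]
  ring

lemma theta4_sq_mul_theta3_zero_sq {τ : ℂ} (hτ : 0 < τ.im) (z : ℂ) :
    theta4 τ z ^ 2 * theta3 τ 0 ^ 2 =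
      theta3 τ z ^ 2 * theta4 τ 0 ^ 2 + theta2 τ 0 ^ 2 * theta1 τ z ^ 2 := by
  simp only [theta1_sq hτ, theta2_sq hτ, theta3_sq hτ, theta4_sq hτ, mul_zero]
  ring

lemma theta4_zero_pow_four {τ : ℂ} (hτ : 0 < τ.im) :
    theta4 τ 0 ^ 4 = (theta3 τ 0 ^ 2) ^ 2 - (theta2 τ 0 ^ 2) ^ 2 := by
  rw [show theta4 τ 0 ^ 4 = (theta4 τ 0 ^ 2) ^ 2 by ring]
  simp only [theta2_sq hτ, theta3_sq hτ, theta4_sq hτ, mul_zero]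
  ring

lemma theta4_two_mul_zero_pow_four {τ : ℂ} (hτ : 0 < τ.im) :
    theta4 (2 * τ) 0 ^ 4 = theta3 τ 0 ^ 2 * theta4 τ 0 ^ 2 := by
  rw [theta4_zero_pow_four (im_two_mul_pos hτ), theta3_sq hτ, theta4_sq hτ, mul_zero]
  ring

lemma theta4_zero_eq_jacobiTheta (τ : ℂ) : theta4 τ 0 = jacobiTheta (τ + 1) := by
  rw [theta4, jacobiTheta]
  refine tsum_congr fun n ↦ ?_
  have h : (-1 : ℂ) ^ n = Complex.exp (π * I * (n : ℂ) ^ 2) := by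
    rw [← Int.cast_pow, show (π : ℂ) * I * ((n ^ 2 : ℤ) : ℂ) = ((n ^ 2 : ℤ) : ℂ) * (π * I) by ring,
      Complex.exp_int_mul, Complex.exp_pi_mul_I]
    rcases Int.even_or_odd n with hn | hn
    · rw [hn.neg_one_zpow, (hn.pow_of_ne_zero two_ne_zero).neg_one_zpow]
    · rw [hn.neg_one_zpow, hn.pow.neg_one_zpow]
  rw [h, mul_zero, Complex.exp_zero, mul_one, ← Complex.exp_add]
  ring_nf

lemma theta4_zero_ne_zero {τ : ℂ} (hτ : 0 < τ.im) : theta4 τ 0 ≠ 0 := by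
  intro h0
  have him : ∀ k : ℕ, (2 ^ k * τ).im = 2 ^ k * τ.im := fun k ↦ by
    simpa using Complex.im_ofReal_mul (2 ^ k) τ
  have hpos : ∀ k : ℕ, 0 < (2 ^ k * τ).im := fun k ↦ by rw [him]; positivity
  have hk : ∀ k : ℕ, theta4 (2 ^ k * τ) 0 = 0 := by
    intro k
    induction k with
    | zero => simpa using h0
    | succ k ih =>
      rw [pow_succ', mul_assoc, ← pow_eq_zero_iff (n := 4) (by norm_num),
        theta4_two_mul_zero_pow_four (hpos k), ih]
      ring
  have htop : Filter.Tendsto (fun k : ℕ ↦ 2 ^ k * τ + 1) Filter.atTop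
      (Filter.comap Complex.im Filter.atTop) := by
    rw [Filter.tendsto_comap_iff]
    refine ((tendsto_pow_atTop_atTop_of_one_lt (one_lt_two (α := ℝ))).atTop_mul_const hτ).congr
      fun k ↦ ?_
    simp [him]
  have hlim := (isBigO_at_im_infty_jacobiTheta_sub_one.comp_tendsto htop).trans_tendsto
    ((Real.tendsto_exp_atBot.comp (Filter.tendsto_id.const_mul_atTop_of_neg
      (neg_neg_of_pos Real.pi_pos))).comp (Filter.tendsto_comap.comp htop))
  have hconst : (fun τ ↦ jacobiTheta τ - 1) ∘ (fun k : ℕ ↦ 2 ^ k * τ + 1) = fun _ ↦ (-1 : ℂ) := by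
    ext k
    simp [← theta4_zero_eq_jacobiTheta, hk k]
  rw [hconst] at hlim
  simpa using tendsto_nhds_unique hlim tendsto_const_nhds

lemma theta3_zero_ne_zero {τ : ℂ} (hτ : 0 < τ.im) : theta3 τ 0 ≠ 0 := by
  intro h
  have h4 := theta4_two_mul_zero_pow_four hτ
  rw [h, zero_pow two_ne_zero, zero_mul] at h4
  exact theta4_zero_ne_zero (im_two_mul_pos hτ) (pow_eq_zero_iff four_ne_zero |>.1 h4)

lemma theta2_zero_ne_zero {τ : ℂ} (hτ : 0 < τ.im) : theta2 τ 0 ≠ 0 := by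
  have hτ0 : τ ≠ 0 := fun h ↦ by simp [h] at hτ
  have him : 0 < (-1 / τ).im := by
    rw [neg_div, one_div, Complex.neg_im, Complex.inv_im, neg_div, neg_neg]
    exact div_pos hτ (Complex.normSq_pos.2 hτ0)
  have h := theta4_zero_ne_zero him
  rw [theta4_eq_theta3, theta3_eq_jacobiTheta₂, jacobiTheta₂_functional_equation,
    show -1 / (-1 / τ) = τ by field_simp,
    show (0 + 1 / 2) / (-1 / τ) = 0 - τ / 2 by field_simp; ring] at h
  rw [theta2_eq_jacobiTheta₂]
  exact mul_ne_zero (Complex.exp_ne_zero _) (right_ne_zero_of_mul h)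

lemma dedekindEta_ne_zero {τ : ℂ} (hτ : 0 < τ.im) : dedekindEta τ ≠ 0 := by
  refine mul_ne_zero (Complex.exp_ne_zero _) ?_
  simpa only [ModularForm.eta_q_eq_pow] using ModularForm.eta_tprod_ne_zero hτ

/-- The difference of the K3 elliptic genus and `24 (θ₃(τ,z)/θ₃(τ,0))²` is proportional to
`θ₁(τ,z)²`. -/
lemma EK3_eq {τ : ℂ} (hτ : 0 < τ.im) (z : ℂ) :
    EK3 τ z = 24 * (theta3 τ z / theta3 τ 0) ^ 2 +
      8 * (theta2 τ 0 ^ 2 / (theta3 τ 0 ^ 2 * theta4 τ 0 ^ 2) -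
        theta4 τ 0 ^ 2 / (theta3 τ 0 ^ 2 * theta2 τ 0 ^ 2)) * theta1 τ z ^ 2 := by
  have h2 := theta2_zero_ne_zero hτ
  have h3 := theta3_zero_ne_zero hτ
  have h4 := theta4_zero_ne_zero hτ
  have e2 : (theta2 τ z / theta2 τ 0) ^ 2 = (theta3 τ z / theta3 τ 0) ^ 2 -
      theta4 τ 0 ^ 2 / (theta3 τ 0 ^ 2 * theta2 τ 0 ^ 2) * theta1 τ z ^ 2 := by
    field_simp
    linear_combination theta2_sq_mul_theta3_zero_sq hτ z
  have e4 : (theta4 τ z / theta4 τ 0) ^ 2 = (theta3 τ z / theta3 τ 0) ^ 2 +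
      theta2 τ 0 ^ 2 / (theta3 τ 0 ^ 2 * theta4 τ 0 ^ 2) * theta1 τ z ^ 2 := by
    field_simp
    linear_combination theta4_sq_mul_theta3_zero_sq hτ z
  rw [EK3, e2, e4]
  ring

/-- There exists a function `e : ℍ → ℂ` such that for every `τ ∈ ℍ` and
every `z ∈ ℂ` the K3 elliptic genus decomposes into `N=4` characters:
`E_K3(τ,z) = -2 χ₀(τ,z) + 20 χ_mm(τ,z) + e(τ)·χ̂(τ,z)`. -/
theorem EK3_N4_decomposition :
    ∃ e : UpperHalfPlane → ℂ, ∀ (τ : UpperHalfPlane) (z : ℂ),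
      EK3 (τ : ℂ) z = -2 * chi0 (τ : ℂ) z + 20 * chimm (τ : ℂ) z +
        e τ * chihat (τ : ℂ) z := by
  refine ⟨fun τ ↦ 2 + (8 * (theta2 τ 0 ^ 2 / (theta3 τ 0 ^ 2 * theta4 τ 0 ^ 2) -
    theta4 τ 0 ^ 2 / (theta3 τ 0 ^ 2 * theta2 τ 0 ^ 2)) * dedekindEta τ ^ 2 -
      24 * mordellH3 τ) * dedekindEta τ / Complex.exp (2 * π * I * (-1/8 : ℂ) * τ), fun τ z ↦ ?_⟩
  have hη := dedekindEta_ne_zero τ.im_pos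
  have hQ := Complex.exp_ne_zero (2 * π * I * (-1/8 : ℂ) * τ)
  beta_reduce
  rw [EK3_eq τ.im_pos, chi0, chimm, chihat]
  generalize 8 * (theta2 τ 0 ^ 2 / (theta3 τ 0 ^ 2 * theta4 τ 0 ^ 2) -
    theta4 τ 0 ^ 2 / (theta3 τ 0 ^ 2 * theta2 τ 0 ^ 2)) = C
  generalize Complex.exp (2 * π * I * (-1/8 : ℂ) * τ) = Q at *
  generalize theta3 τ z / theta3 τ 0 = A
  field_simp
  ring
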